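/- (Berg–Vignat formula for equal degrees) Let n be a natural number, let i satisfy 0 ≤ i ≤ n, and let a be any real number. Then β_{n+i}^{(n,n)}(a) = ((4a(1−a))^i / 4^n) · ((−n)_i (n+1/2)_i)/(i! · (1/2 − n)_i) · Σ_{j=0}^{n−i} ((−n+i)_j (−n−1/2)_j)/((1/2)_j · j!) · (2a−1)^{2j} (the terminating series ₂F₁(−n+i, −n−1/2; 1/2; (2a−1)²)); note that (1/2 − n)_i is a product of nonzero half-integers, so the denominators are nonzero. -/

import Mathlib

open Finset

/-- The Bessel polynomial `q_n`, normalized so that `q_n(0) = 1`. -/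
noncomputable def besselQ (n : ℕ) (u : ℝ) : ℝ :=
  ∑ k ∈ Finset.range (n + 1),
    ((n.factorial : ℝ) * (2 * n - k).factorial * 2 ^ k) /
      ((2 * n).factorial * (n - k).factorial * k.factorial) * u ^ k

/-- The Pochhammer symbol `(x)_j = x (x+1) ⋯ (x+j-1)`. -/
noncomputable def poch (x : ℝ) (j : ℕ) : ℝ := ∏ i ∈ Finset.range j, (x + i)

/-- Generalized binomial coefficient with integer (possibly negative) upper entry. -/
noncomputable def gbinom (z : ℤ) (j : ℕ) : ℝ :=
  (∏ i ∈ Finset.range j, ((z : ℝ) - i)) / j.factorial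


lemma poch_zero' (x : ℝ) : poch x 0 = 1 := by simp [poch]

lemma poch_succ' (x : ℝ) (j : ℕ) : poch x (j + 1) = poch x j * (x + j) := by
  simp [poch, Finset.prod_range_succ]

lemma poch_succ_left (x : ℝ) (j : ℕ) : poch x (j + 1) = x * poch (x + 1) j := by
  unfold poch
  rw [Finset.prod_range_succ']
  rw [mul_comm]
  congr 1
  · simp
  · apply Finset.prod_congr rfl
    intro i _
    push_cast
    ring

lemma poch_add' (x : ℝ) (i j : ℕ) : poch x (i + j) = poch x i * poch (x + i) j := by
  unfold poch
  rw [Finset.prod_range_add]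
  congr 1
  apply Finset.prod_congr rfl
  intro k _
  push_cast
  ring

lemma poch_reflect (x : ℝ) (k : ℕ) : poch x k = (-1) ^ k * poch (1 - x - k) k := by
  induction k generalizing x with
  | zero => simp [poch]
  | succ k ih =>
    rw [poch_succ_left, ih (x + 1), poch_succ' (1 - x - _)]
    have : (1 - (x + 1) - (k : ℝ)) = 1 - x - ((k + 1 : ℕ) : ℝ) := by push_cast; ring
    rw [this]
    push_cast
    ring

lemma poch_ne (x : ℝ) (k : ℕ) (h : ∀ i : ℕ, x + i ≠ 0) : poch x k ≠ 0 := by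
  unfold poch
  exact Finset.prod_ne_zero_iff.mpr fun i _ => h i

lemma half_ne (n i : ℕ) : (1 / 2 - (n : ℝ)) + i ≠ 0 := by
  intro h
  have h2 : (1 : ℝ) + 2 * i = 2 * n := by linarith
  have h3 : 1 + 2 * i = 2 * n := by exact_mod_cast h2
  omega

lemma poch_half_ne (n k : ℕ) : poch (1 / 2 - (n : ℝ)) k ≠ 0 := poch_ne _ _ (half_ne n)

lemma poch_half_ne0 (k : ℕ) : poch (1 / 2 : ℝ) k ≠ 0 := by
  simpa using poch_half_ne 0 k

lemma poch_half_sub_ne (n i k : ℕ) : poch (1 / 2 - (n : ℝ) - i) k ≠ 0 := by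
  have := poch_half_ne (n + i) k
  push_cast at this
  rwa [← sub_sub] at this

lemma vand (a b : ℝ) (N : ℕ) : ∑ x ∈ antidiagonal N, (N.choose x.1 : ℝ) * (poch a x.1 * poch b x.2)
    = poch (a + b) N := by
  induction N with
  | zero => simp [poch]
  | succ N ih =>
    rw [Finset.sum_antidiagonal_choose_succ_mul (fun i j => poch a i * poch b j), poch_succ', ← ih,
      ← Finset.sum_add_distrib, Finset.sum_mul]
    apply Finset.sum_congr rfl
    rintro ⟨i, j⟩ h
    rw [HasAntidiagonal.mem_antidiagonal] at h
    simp only at h ⊢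
    subst h
    rw [poch_succ', poch_succ', Nat.choose_symm_add]
    push_cast
    ring

lemma expand (N : ℕ) (α γ x : ℝ) :
    ∑ p ∈ antidiagonal N, (N.choose p.1 : ℝ) * ((-1) ^ p.1 * poch α p.1 * poch (γ + p.1) p.2 * (1 - x) ^ p.1)
    = ∑ p ∈ antidiagonal N, (N.choose p.1 : ℝ) * (x ^ p.1 * poch α p.1 * poch (γ - α) p.2) := by
  induction N generalizing α γ with
  | zero => simp [poch]
  | succ N ih =>
    rw [Finset.sum_antidiagonal_choose_succ_mul
        (fun i j => (-1) ^ i * poch α i * poch (γ + i) j * (1 - x) ^ i),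
      Finset.sum_antidiagonal_choose_succ_mul (fun i j => x ^ i * poch α i * poch (γ - α) j)]
    have h1 : ∑ p ∈ antidiagonal N, (N.choose p.1 : ℝ) *
        ((-1) ^ p.1 * poch α p.1 * poch (γ + p.1) (p.2 + 1) * (1 - x) ^ p.1) = (γ + N) *
        ∑ p ∈ antidiagonal N, (N.choose p.1 : ℝ) * (x ^ p.1 * poch α p.1 * poch (γ - α) p.2) := by
      rw [← ih, Finset.mul_sum]
      apply Finset.sum_congr rfl
      rintro ⟨i, j⟩ h
      rw [HasAntidiagonal.mem_antidiagonal] at h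
      simp only at h ⊢
      subst h
      rw [poch_succ']
      push_cast
      ring
    have h2 : ∑ p ∈ antidiagonal N, (N.choose p.2 : ℝ) *
        ((-1) ^ (p.1 + 1) * poch α (p.1 + 1) * poch (γ + (p.1 + 1 : ℕ)) p.2 * (1 - x) ^ (p.1 + 1))
        = (- α * (1 - x)) *
        ∑ p ∈ antidiagonal N, (N.choose p.1 : ℝ) *
          (x ^ p.1 * poch (α + 1) p.1 * poch (γ - α) p.2) := by
      have := ih (α + 1) (γ + 1)
      rw [show γ + 1 - (α + 1) = γ - α by ring] at this
      rw [← this, Finset.mul_sum]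
      apply Finset.sum_congr rfl
      rintro ⟨i, j⟩ h
      rw [HasAntidiagonal.mem_antidiagonal] at h
      simp only at h ⊢
      subst h
      rw [poch_succ_left, Nat.choose_symm_add]
      push_cast
      rw [show γ + ((i : ℝ) + 1) = γ + 1 + i by ring]
      ring
    rw [h1, h2, Finset.mul_sum, Finset.mul_sum, ← Finset.sum_add_distrib, ← Finset.sum_add_distrib]
    apply Finset.sum_congr rfl
    rintro ⟨i, j⟩ h
    rw [HasAntidiagonal.mem_antidiagonal] at h
    simp only at h ⊢
    subst h
    have e : α * poch (α + 1) i = poch α i * (α + i) := by rw [← poch_succ_left, poch_succ']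
    rw [poch_succ', poch_succ', Nat.choose_symm_add]
    push_cast
    linear_combination (-(1 - x) * ((i + j).choose j : ℝ) * x ^ i * poch (γ - α) j) * e

lemma poch_neg (N j : ℕ) : poch (-(N : ℝ)) j = (-1) ^ j * N.choose j * j.factorial := by
  induction j with
  | zero => simp [poch]
  | succ j ih =>
    rw [poch_succ', ih]
    have h : ((N.choose (j + 1) : ℕ) : ℝ) * (j + 1) = N.choose j * (N - j) := by
      have h0 := Nat.choose_succ_right_eq N j
      rcases le_or_gt j N with hj | hj
      · have : ((N.choose (j + 1) * (j + 1) : ℕ) : ℝ) = (N.choose j * (N - j) : ℕ) := by rw [h0]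
        push_cast [Nat.cast_sub hj] at this
        exact this
      · rw [Nat.choose_eq_zero_of_lt hj, Nat.choose_eq_zero_of_lt (by omega)]
        simp
    rw [Nat.factorial_succ]
    push_cast
    linear_combination (-1) ^ j * (j.factorial : ℝ) * h

lemma poch_ratio (c : ℝ) (i p : ℕ) :
    poch (1 - c) i * poch c p = poch (1 - c - p) i * poch (c - i) p := by
  have h1 := poch_add' (c - i) i p
  have h2 := poch_add' (c - i) p i
  rw [add_comm p i] at h2
  rw [h1, poch_reflect (c - i) i, poch_reflect (c - i + p) i] at h2
  rw [show c - (i : ℝ) + i = c by ring, show 1 - (c - (i : ℝ)) - i = 1 - c by ring,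
    show 1 - (c - (i : ℝ) + p) - i = 1 - c - p by ring] at h2
  have h3 : ((-1 : ℝ) ^ i) ≠ 0 := by simp
  apply mul_left_cancel₀ h3
  linear_combination h2

lemma poch_half_split (i N : ℕ) :
    poch (1 / 2 - ((i + N : ℕ) : ℝ)) i * poch (1 / 2) N = (-1) ^ i * poch (1 / 2) (i + N) := by
  rw [add_comm i N, poch_add', poch_reflect]
  rw [show 1 - (1 / 2 - ((N + i : ℕ) : ℝ)) - i = 1 / 2 + N by push_cast; ring]
  ring

lemma inner_bsum (i N : ℕ) (a : ℝ) :
    ∑ j ∈ Finset.range (N + 1),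
        poch (-(N : ℝ)) j * poch (-((i + N : ℕ) : ℝ) - 1/2) j /
          (poch (1/2) j * j.factorial) * (2 * a - 1) ^ (2 * j) =
    (∑ q ∈ antidiagonal N, (N.choose q.1 : ℝ) * ((4 * a * (1 - a)) ^ q.1 *
      poch (-((i + N : ℕ) : ℝ) - 1/2) q.1 * poch (((i + N : ℕ) : ℝ) + 1) q.2)) / poch (1 / 2) N := by
  have h := expand N (-((i + N : ℕ) : ℝ) - 1/2) (1 / 2) (4 * a * (1 - a))
  rw [show (1 / 2 : ℝ) - (-((i + N : ℕ) : ℝ) - 1/2) = ((i + N : ℕ) : ℝ) + 1 by ring] at h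
  rw [← h, ← Finset.Nat.sum_antidiagonal_eq_sum_range_succ_mk
    (f := fun q : ℕ × ℕ => poch (-(N : ℝ)) q.1 * poch (-((i + N : ℕ) : ℝ) - 1/2) q.1 /
          (poch (1/2) q.1 * q.1.factorial) * (2 * a - 1) ^ (2 * q.1)), Finset.sum_div]
  apply Finset.sum_congr rfl
  rintro ⟨j, l⟩ hj
  rw [HasAntidiagonal.mem_antidiagonal] at hj
  simp only at hj ⊢
  rw [poch_neg]
  have h1 : poch (1 / 2 : ℝ) N = poch (1 / 2) j * poch (1 / 2 + j) l := by rw [← hj, poch_add']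
  have h2 := poch_half_ne0 j
  have h3 := poch_half_ne0 N
  have h4 : poch (1 / 2 + (j : ℝ)) l ≠ 0 := by
    intro h5
    rw [h5, mul_zero] at h1
    exact h3 h1
  have h5 : (j.factorial : ℝ) ≠ 0 := by positivity
  rw [h1, pow_mul, show (2 * a - 1) ^ 2 = 1 - 4 * a * (1 - a) by ring]
  generalize poch (1 / 2 + (j : ℝ)) l = v at *
  field_simp

/-- The explicit coefficient. -/
noncomputable def Bc (n : ℕ) (a : ℝ) (i : ℕ) : ℝ := (4 * a * (1 - a)) ^ i / 4 ^ n *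
      (poch (-(n : ℝ)) i * poch ((n : ℝ) + 1/2) i) /
        (i.factorial * poch (1/2 - (n : ℝ)) i) *
      ∑ j ∈ Finset.range (n - i + 1),
        poch (-(n : ℝ) + i) j * poch (-(n : ℝ) - 1/2) j /
          (poch (1/2) j * j.factorial) * (2 * a - 1) ^ (2 * j)

lemma Bc_term (i N p : ℕ) (a : ℝ) :
    Bc (i + N) a i / poch (1 / 2 - ((i + N : ℕ) : ℝ) - i) p =
    1 / (4 ^ (i + N) * poch (1 / 2) (i + N) * poch (1 / 2 - ((i + N : ℕ) : ℝ)) p) *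
    ∑ q ∈ antidiagonal N, ((i + N).choose i : ℝ) * (N.choose q.1 : ℝ) * (4 * a * (1 - a)) ^ (i + q.1) *
      (poch (((i + N : ℕ) : ℝ) + 1/2 - p) i *
      poch (-((i + N : ℕ) : ℝ) - 1/2) q.1) * poch (((i + N : ℕ) : ℝ) + 1) q.2 := by
  unfold Bc
  have e : (-((i + N : ℕ) : ℝ) + i) = -(N : ℝ) := by push_cast; ring
  rw [Nat.add_sub_cancel_left, e, inner_bsum]
  have hs : ∑ q ∈ antidiagonal N, ((i + N).choose i : ℝ) * (N.choose q.1 : ℝ) * (4 * a * (1 - a)) ^ (i + q.1) *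
      (poch (((i + N : ℕ) : ℝ) + 1/2 - p) i *
      poch (-((i + N : ℕ) : ℝ) - 1/2) q.1) * poch (((i + N : ℕ) : ℝ) + 1) q.2 =
      ((i + N).choose i : ℝ) * (4 * a * (1 - a)) ^ i * poch (((i + N : ℕ) : ℝ) + 1/2 - p) i *
      ∑ q ∈ antidiagonal N, (N.choose q.1 : ℝ) * ((4 * a * (1 - a)) ^ q.1 *
      poch (-((i + N : ℕ) : ℝ) - 1/2) q.1 * poch (((i + N : ℕ) : ℝ) + 1) q.2) := by
    rw [Finset.mul_sum]
    apply Finset.sum_congr rfl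
    intro q _
    rw [pow_add]
    ring
  rw [hs]
  generalize ∑ q ∈ antidiagonal N, (N.choose q.1 : ℝ) * ((4 * a * (1 - a)) ^ q.1 *
      poch (-((i + N : ℕ) : ℝ) - 1/2) q.1 * poch (((i + N : ℕ) : ℝ) + 1) q.2) = S
  rw [poch_neg]
  have h1 := poch_ratio (1 / 2 - ((i + N : ℕ) : ℝ)) i p
  rw [show (1 : ℝ) - (1 / 2 - ((i + N : ℕ) : ℝ)) = ((i + N : ℕ) : ℝ) + 1 / 2 by ring] at h1
  have h2 := poch_half_split i N
  have g1 := poch_half_ne (i + N) p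
  have g2 := poch_half_ne (i + N) i
  have g3 := poch_half_sub_ne (i + N) i p
  have g4 := poch_half_ne0 N
  have g5 := poch_half_ne0 (i + N)
  have g6 : (i.factorial : ℝ) ≠ 0 := by positivity
  have g7 : (4 : ℝ) ^ (i + N) ≠ 0 := by positivity
  generalize poch (1 / 2 - ((i + N : ℕ) : ℝ)) p = u1 at *
  generalize poch (1 / 2 - ((i + N : ℕ) : ℝ)) i = u2 at *
  generalize poch (1 / 2 - ((i + N : ℕ) : ℝ) - i) p = u3 at *
  generalize poch (1 / 2 : ℝ) N = u4 at *
  generalize poch (1 / 2 : ℝ) (i + N) = u5 at *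
  generalize poch (((i + N : ℕ) : ℝ) + 1 / 2) i = u6 at *
  generalize poch (((i + N : ℕ) : ℝ) + 1 / 2 - p) i = u7 at *
  generalize (4 : ℝ) ^ (i + N) = u8 at *
  generalize ((i + N).choose i : ℝ) = u9 at *
  generalize (4 * a * (1 - a)) ^ i = u10 at *
  field_simp
  have h3 : (-1 : ℝ) ^ i * u5 * (u6 * u1) = (u2 * u4) * (u7 * u3) := by
    rw [h1, ← h2]
  linear_combination (S * u9 * u10) * h3

lemma triple (f : ℕ → ℕ → ℕ → ℝ) (n : ℕ) :
    ∑ q ∈ antidiagonal n, ∑ r ∈ antidiagonal q.2, f q.1 r.1 r.2 =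
    ∑ q ∈ antidiagonal n, ∑ r ∈ antidiagonal q.1, f r.1 r.2 q.2 := by
  rw [Finset.sum_sigma', Finset.sum_sigma']
  refine Finset.sum_nbij' (fun x => ⟨(x.1.1 + x.2.1, x.2.2), (x.1.1, x.2.1)⟩)
    (fun x => ⟨(x.2.1, x.2.2 + x.1.2), (x.2.2, x.1.2)⟩) ?_ ?_ ?_ ?_ ?_
  all_goals
    rintro ⟨⟨i, j⟩, ⟨k, l⟩⟩ h
    simp only [Finset.mem_sigma, HasAntidiagonal.mem_antidiagonal] at h ⊢
  · obtain ⟨h1, h2⟩ := h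
    constructor
    · omega
    · trivial
  · obtain ⟨h1, h2⟩ := h
    constructor
    · omega
    · trivial
  · obtain ⟨h1, h2⟩ := h
    subst h2
    rfl
  · obtain ⟨h1, h2⟩ := h
    subst h2
    rfl

lemma Bc_sum (n p : ℕ) (a : ℝ) :
    ∑ i ∈ Finset.range (n + 1), Bc n a i / poch (1 / 2 - (n : ℝ) - i) p =
    1 / (4 ^ n * poch (1 / 2) n * poch (1 / 2 - (n : ℝ)) p) *
    ∑ q ∈ antidiagonal n, (n.choose q.1 : ℝ) * poch (-(p : ℝ)) q.1 * poch ((n : ℝ) + 1) q.2 *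
      (4 * a * (1 - a)) ^ q.1 := by
  rw [← Finset.Nat.sum_antidiagonal_eq_sum_range_succ_mk
    (f := fun q : ℕ × ℕ => Bc n a q.1 / poch (1 / 2 - (n : ℝ) - q.1) p)]
  have h1 : ∀ q ∈ antidiagonal n, Bc n a q.1 / poch (1 / 2 - (n : ℝ) - q.1) p =
    1 / (4 ^ n * poch (1 / 2) n * poch (1 / 2 - (n : ℝ)) p) *
    ∑ r ∈ antidiagonal q.2, (n.choose q.1 : ℝ) * (q.2.choose r.1 : ℝ) * (4 * a * (1 - a)) ^ (q.1 + r.1) *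
      (poch ((n : ℝ) + 1/2 - p) q.1 *
      poch (-(n : ℝ) - 1/2) r.1) * poch ((n : ℝ) + 1) r.2 := by
    rintro ⟨i, N⟩ h
    rw [HasAntidiagonal.mem_antidiagonal] at h
    simp only at h ⊢
    subst h
    exact Bc_term i N p a
  rw [Finset.sum_congr rfl h1, ← Finset.mul_sum]
  congr 1
  have h2 : ∀ q ∈ antidiagonal n, ∑ r ∈ antidiagonal q.2, (n.choose q.1 : ℝ) * (q.2.choose r.1 : ℝ) *
      (4 * a * (1 - a)) ^ (q.1 + r.1) * (poch ((n : ℝ) + 1/2 - p) q.1 *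
      poch (-(n : ℝ) - 1/2) r.1) * poch ((n : ℝ) + 1) r.2 =
      ∑ r ∈ antidiagonal q.2, (n.choose q.1 : ℝ) * ((r.1 + r.2).choose r.1 : ℝ) *
      (4 * a * (1 - a)) ^ (q.1 + r.1) * (poch ((n : ℝ) + 1/2 - p) q.1 *
      poch (-(n : ℝ) - 1/2) r.1) * poch ((n : ℝ) + 1) r.2 := by
    intro q _
    apply Finset.sum_congr rfl
    intro r hr
    rw [HasAntidiagonal.mem_antidiagonal] at hr
    rw [hr]
  rw [Finset.sum_congr rfl h2, triple (fun i r l => (n.choose i : ℝ) * ((r + l).choose r : ℝ) *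
      (4 * a * (1 - a)) ^ (i + r) * (poch ((n : ℝ) + 1/2 - p) i *
      poch (-(n : ℝ) - 1/2) r) * poch ((n : ℝ) + 1) l)]
  apply Finset.sum_congr rfl
  rintro ⟨R, l⟩ h
  rw [HasAntidiagonal.mem_antidiagonal] at h
  simp only at h ⊢
  have hv := vand ((n : ℝ) + 1/2 - p) (-(n : ℝ) - 1/2) R
  rw [show ((n : ℝ) + 1/2 - p) + (-(n : ℝ) - 1/2) = -(p : ℝ) by ring] at hv
  rw [← hv, Finset.mul_sum, Finset.sum_mul, Finset.sum_mul]
  apply Finset.sum_congr rfl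
  rintro ⟨i, r⟩ h'
  rw [HasAntidiagonal.mem_antidiagonal] at h'
  simp only at h' ⊢
  have hc : n.choose i * (r + l).choose r = n.choose R * R.choose i := by
    have := Nat.choose_mul (n := n) (k := R) (s := i) (by omega)
    rw [this]
    congr 2 <;> omega
  have hc' : (n.choose i : ℝ) * (r + l).choose r = n.choose R * R.choose i := by exact_mod_cast hc
  rw [hc', h']
  ring

section PolyPart
open Polynomial

/-- Euler operator. -/
noncomputable def eul (P : ℝ[X]) : ℝ[X] := X * derivative P

/-- Second order Bessel operator, multiplied by `X ^ 2`. -/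
noncomputable def bop (n : ℕ) (P : ℝ[X]) : ℝ[X] := eul (eul P) - C (1 + 2 * (n : ℝ)) * eul P

lemma eul_mul (P Q : ℝ[X]) : eul (P * Q) = eul P * Q + P * eul Q := by
  simp only [eul, derivative_mul]; ring

lemma eul_add (P Q : ℝ[X]) : eul (P + Q) = eul P + eul Q := by
  simp only [eul, derivative_add]; ring

lemma eul_C (c : ℝ) : eul (C c) = 0 := by simp [eul]

lemma eul_X_pow (r : ℕ) : eul (X ^ r) = C (r : ℝ) * X ^ r := by
  cases r with
  | zero => simp [eul]
  | succ r => simp [eul]; ring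

lemma eul_w_pow (y : ℝ) (m : ℕ) :
    eul ((X + C y) ^ (m + 1)) = C ((m : ℝ) + 1) * X * (X + C y) ^ m := by
  simp [eul, derivative_pow]; ring

lemma bop_C_mul (n : ℕ) (c : ℝ) (P : ℝ[X]) : bop n (C c * P) = C c * bop n P := by
  have h : ∀ P, eul (C c * P) = C c * eul P := by
    intro P
    rw [eul_mul, eul_C]
    ring
  simp only [bop, h]
  ring

lemma bop_sum {ι : Type*} (n : ℕ) (s : Finset ι) (f : ι → ℝ[X]) :
    bop n (∑ i ∈ s, f i) = ∑ i ∈ s, bop n (f i) := by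
  simp only [bop, eul, derivative_sum, Finset.mul_sum, Finset.sum_sub_distrib]

lemma bop_coeff (n l : ℕ) (P : ℝ[X]) :
    (bop n P).coeff l = (l : ℝ) * ((l : ℝ) - 1 - 2 * n) * P.coeff l := by
  have h : ∀ P : ℝ[X], (eul P).coeff l = l * P.coeff l := by
    intro P
    cases l with
    | zero => simp [eul]
    | succ l => simp [eul, coeff_X_mul, coeff_derivative]; ring
  rw [bop, coeff_sub, coeff_C_mul, h, h]
  ring

lemma bop_X_pow (n r : ℕ) : bop n (X ^ r) = C ((r : ℝ) * ((r : ℝ) - 1 - 2 * n)) * X ^ r := by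
  rw [bop, eul_X_pow, eul_mul, eul_C, eul_X_pow]
  simp only [C_mul, C_sub, C_add, C_1]
  ring

/-- Terms. -/
lemma bop_term (n r q : ℕ) (y : ℝ) :
    bop n (X ^ r * (X + C y) ^ (2 * (q + 1))) =
      C ((r : ℝ) * ((r : ℝ) - 1 - 2 * n)) * X ^ r * (X + C y) ^ (2 * (q + 1)) +
      C (2 * ((q : ℝ) + 1) * (2 * r - 2 * n)) * X ^ (r + 1) * (X + C y) ^ (2 * q) * (X + C y) +
      C (2 * ((q : ℝ) + 1) * (2 * q + 1)) * X ^ (r + 2) * (X + C y) ^ (2 * q) := by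
  have h1 : eul ((X + C y) ^ (2 * q + 1 + 1)) = C (2 * (q : ℝ) + 2) * X * (X + C y) ^ (2 * q + 1) := by
    rw [eul_w_pow]; congr 3; push_cast; ring
  have h2 : eul ((X + C y) ^ (2 * q + 1)) = C (2 * (q : ℝ) + 1) * X * (X + C y) ^ (2 * q) := by
    rw [eul_w_pow]; congr 3; push_cast; ring
  have h3 : eul (X : ℝ[X]) = X := by simp [eul]
  rw [show 2 * (q + 1) = 2 * q + 1 + 1 by ring]
  simp only [bop, eul_mul, eul_add, eul_X_pow, h1, h2, eul_C, h3]
  simp only [C_mul, C_sub, C_add, C_1, map_ofNat]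
  ring

lemma bop_uniq (n : ℕ) (P Q : ℝ[X]) (hP : P.natDegree ≤ 2 * n) (hQ : Q.natDegree ≤ 2 * n)
    (h0 : P.coeff 0 = Q.coeff 0) (h : bop n P = bop n Q) : P = Q := by
  ext l
  rcases Nat.lt_or_ge (2 * n) l with hl | hl
  · rw [coeff_eq_zero_of_natDegree_lt (by omega), coeff_eq_zero_of_natDegree_lt (by omega)]
  · rcases Nat.eq_zero_or_pos l with h1 | h1
    · rw [h1, h0]
    · have h2 := congrArg (fun P => coeff P l) h
      simp only [bop_coeff] at h2
      have h3 : (l : ℝ) * ((l : ℝ) - 1 - 2 * n) ≠ 0 := by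
        have h4 : (l : ℝ) ≤ 2 * n := by exact_mod_cast hl
        have h5 : (0 : ℝ) < l := by exact_mod_cast h1
        apply mul_ne_zero h5.ne'
        linarith
      exact mul_left_cancel₀ h3 h2

/-- `1 / ((c)_k k!)` with `c = 1/2 - n`. -/
noncomputable def ec (n k : ℕ) : ℝ := 1 / (poch (1 / 2 - (n : ℝ)) k * k.factorial)

lemma ec_succ (n k : ℕ) : ((k : ℝ) + 1) * (1 / 2 - n + k) * ec n (k + 1) = ec n k := by
  unfold ec
  have h1 := poch_half_ne n k
  have h2 := half_ne n k
  rw [poch_succ', Nat.factorial_succ]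
  have h3 : (k.factorial : ℝ) ≠ 0 := by positivity
  push_cast
  generalize (1 / 2 - (n : ℝ) + k) = v at *
  field_simp

/-- Left polynomial. -/
noncomputable def Mp (n : ℕ) (y : ℝ) (p : ℕ) : ℝ[X] :=
  ∑ q ∈ antidiagonal p, C (ec n q.1 * ec n q.2 * y ^ (2 * q.2)) * X ^ (2 * q.1)

/-- Coefficient of the right polynomial. -/
noncomputable def Ac (n p r : ℕ) : ℝ :=
  (n.choose r : ℝ) * poch (-(p : ℝ)) r * poch ((n : ℝ) + 1) (n - r) * 4 ^ r

/-- Right polynomial. -/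
noncomputable def Rp (n : ℕ) (y : ℝ) (p : ℕ) : ℝ[X] :=
  ∑ q ∈ antidiagonal p, C (Ac n p q.1 * y ^ q.1) * (X ^ q.1 * (X + C y) ^ (2 * q.2))

lemma bop_Mp (n : ℕ) (y : ℝ) (p : ℕ) : bop n (Mp n y (p + 1)) = C 4 * X ^ 2 * Mp n y p := by
  unfold Mp
  rw [bop_sum, Finset.Nat.sum_antidiagonal_succ, Finset.mul_sum]
  rw [bop_C_mul, bop_X_pow]
  simp only [Nat.cast_zero, zero_mul, C_0, mul_zero, zero_add]
  apply Finset.sum_congr rfl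
  rintro ⟨i, j⟩ _
  simp only
  rw [bop_C_mul, bop_X_pow, ← ec_succ n i]
  have e : (ec n (i + 1) * ec n j * y ^ (2 * j)) *
      (((2 * (i + 1) : ℕ) : ℝ) * (((2 * (i + 1) : ℕ) : ℝ) - 1 - 2 * n)) =
      4 * (((i : ℝ) + 1) * (1 / 2 - n + i) * ec n (i + 1) * ec n j * y ^ (2 * j)) := by
    push_cast
    ring
  rw [← mul_assoc, ← C_mul, e, C_mul]
  ring

lemma Ac_succ_r (n p r : ℕ) (hr : r ≤ n) :
    Ac n (p + 1) (r + 1) * (((r + 1 : ℕ) : ℝ) * (((r + 1 : ℕ) : ℝ) - 1 - 2 * n)) =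
    4 * ((r : ℝ) - n) * (r - (p + 1)) * Ac n (p + 1) r := by
  unfold Ac
  rcases Nat.eq_or_lt_of_le hr with h | h
  · subst h
    simp
  · obtain ⟨m, rfl⟩ := Nat.exists_eq_add_of_lt h
    have h0 := Nat.choose_succ_right_eq (r + m + 1) r
    have h1 : (((r + m + 1).choose (r + 1) * (r + 1) : ℕ) : ℝ) =
      ((r + m + 1).choose r * (r + m + 1 - r) : ℕ) := by rw [h0]
    rw [show r + m + 1 - r = m + 1 by omega] at h1 ⊢
    rw [show r + m + 1 - (r + 1) = m by omega, poch_succ', poch_succ' _ m]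
    push_cast at h1 ⊢
    linear_combination (-(r : ℝ) - 2 * m - 2) * (r - (p + 1)) *
      poch (-((p : ℝ) + 1)) r * poch ((r : ℝ) + m + 1 + 1) m * 4 ^ (r + 1) * h1

lemma Ac_succ_p (n p r : ℕ) : ((p : ℝ) + 1 - r) * Ac n (p + 1) r = (p + 1) * Ac n p r := by
  unfold Ac
  have h : ((p : ℝ) + 1 - r) * poch (-((p + 1 : ℕ) : ℝ)) r = (p + 1) * poch (-(p : ℝ)) r := by
    have h1 := poch_succ' (-((p + 1 : ℕ) : ℝ)) r
    rw [poch_succ_left] at h1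
    rw [show -((p + 1 : ℕ) : ℝ) + 1 = -(p : ℝ) by push_cast; ring] at h1
    push_cast at h1 ⊢
    linear_combination h1
  linear_combination (n.choose r : ℝ) * poch ((n : ℝ) + 1) (n - r) * 4 ^ r * h

lemma bop_Rp (n : ℕ) (y : ℝ) (p : ℕ) (hp : p + 1 ≤ n) : bop n (Rp n y (p + 1)) =
    C (2 * ((p : ℝ) + 1) * (2 * (p + 1) - 2 * n - 1)) * X ^ 2 * Rp n y p := by
  unfold Rp
  rw [bop_sum]
  have key : ∀ r q : ℕ, bop n (X ^ r * (X + C y) ^ (2 * q)) =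
      C ((r : ℝ) * ((r : ℝ) - 1 - 2 * n)) * X ^ r * (X + C y) ^ (2 * q) +
      (C (2 * (q : ℝ) * (2 * r - 2 * n)) * X ^ (r + 1) * (X + C y) ^ (2 * (q - 1)) * (X + C y) +
      C (2 * (q : ℝ) * (2 * q - 1)) * X ^ (r + 2) * (X + C y) ^ (2 * (q - 1))) := by
    intro r q
    cases q with
    | zero => simp [bop_X_pow]
    | succ q =>
      rw [bop_term, Nat.add_sub_cancel, add_assoc]
      push_cast
      rw [show 2 * ((q : ℝ) + 1) - 1 = 2 * q + 1 by ring]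
  simp only [bop_C_mul, key, mul_add (C (Ac n (p + 1) _ * y ^ _))]
  rw [Finset.sum_add_distrib, Finset.Nat.sum_antidiagonal_succ, Finset.Nat.sum_antidiagonal_succ']
  simp only [Nat.cast_zero, zero_mul, C_0, mul_zero, zero_add, add_zero]
  rw [← Finset.sum_add_distrib, Finset.mul_sum]
  apply Finset.sum_congr rfl
  rintro ⟨r, q⟩ h
  rw [HasAntidiagonal.mem_antidiagonal] at h
  simp only at h ⊢
  rw [Nat.add_sub_cancel]
  have h1 := Ac_succ_r n p r (by omega)
  have h2 := Ac_succ_p n p r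
  have h3 : (p : ℝ) = r + q := by exact_mod_cast h.symm
  have e1 : Ac n (p + 1) (r + 1) * y ^ (r + 1) *
        (((r + 1 : ℕ) : ℝ) * (((r + 1 : ℕ) : ℝ) - 1 - 2 * n)) +
      Ac n (p + 1) r * y ^ r * (2 * ((q + 1 : ℕ) : ℝ) * (2 * r - 2 * n)) * y = 0 := by
    rw [h3] at h1
    push_cast at h1 ⊢
    linear_combination y ^ (r + 1) * h1
  have e2 : Ac n (p + 1) r * y ^ r * (2 * ((q + 1 : ℕ) : ℝ) * (2 * r - 2 * n)) +
      Ac n (p + 1) r * y ^ r * (2 * ((q + 1 : ℕ) : ℝ) * (2 * ((q + 1 : ℕ) : ℝ) - 1)) =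
      2 * ((p : ℝ) + 1) * (2 * (p + 1) - 2 * n - 1) * (Ac n p r * y ^ r) := by
    rw [h3] at h2 ⊢
    push_cast
    linear_combination (2 * (2 * ((r : ℝ) + q + 1) - 2 * n - 1) * y ^ r) * h2
  calc _ = C (Ac n (p + 1) (r + 1) * y ^ (r + 1) *
        (((r + 1 : ℕ) : ℝ) * (((r + 1 : ℕ) : ℝ) - 1 - 2 * n)) +
      Ac n (p + 1) r * y ^ r * (2 * ((q + 1 : ℕ) : ℝ) * (2 * r - 2 * n)) * y) *
      (X ^ (r + 1) * (X + C y) ^ (2 * q)) +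
      C (Ac n (p + 1) r * y ^ r * (2 * ((q + 1 : ℕ) : ℝ) * (2 * r - 2 * n)) +
      Ac n (p + 1) r * y ^ r * (2 * ((q + 1 : ℕ) : ℝ) * (2 * ((q + 1 : ℕ) : ℝ) - 1))) *
      (X ^ (r + 2) * (X + C y) ^ (2 * q)) := by
        generalize ((q + 1 : ℕ) : ℝ) = q1
        generalize ((r + 1 : ℕ) : ℝ) = r1
        simp only [C_mul, C_add, C_sub]
        ring
    _ = _ := by
        rw [e1, e2, C_mul, C_0]
        ring

lemma poch_central (n : ℕ) : poch ((n : ℝ) + 1) n = 4 ^ n * poch (1 / 2) n := by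
  induction n with
  | zero => simp [poch]
  | succ n ih =>
    have h1 := poch_succ_left ((n : ℝ) + 1) (n + 1)
    rw [poch_succ', poch_succ', ih] at h1
    have h2 : (n : ℝ) + 1 ≠ 0 := by positivity
    apply mul_left_cancel₀ h2
    push_cast at h1 ⊢
    rw [← h1, poch_succ' (1 / 2)]
    ring

lemma Mp_eq (n : ℕ) (y : ℝ) (p : ℕ) (hp : p ≤ n) :
    Mp n y p = C (ec n p / (4 ^ n * poch (1 / 2) n)) * Rp n y p := by
  have hne : (4 : ℝ) ^ n * poch (1 / 2) n ≠ 0 := mul_ne_zero (by positivity) (poch_half_ne0 n)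
  induction p with
  | zero =>
    have hM : Mp n y 0 = C (ec n 0 * ec n 0) := by simp [Mp]
    have hR : Rp n y 0 = C (Ac n 0 0) := by simp [Rp]
    have h1 : ec n 0 = 1 := by simp [ec, poch]
    have h2 : Ac n 0 0 = 4 ^ n * poch (1 / 2) n := by
      simp only [Ac, poch_zero', Nat.sub_zero, poch_central]
      simp
    rw [hM, hR, ← C_mul, h1, h2]
    congr 1
    generalize (4 : ℝ) ^ n * poch (1 / 2) n = v at *
    field_simp
  | succ p ih =>
    apply bop_uniq n
    · unfold Mp
      apply natDegree_sum_le_of_forall_le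
      rintro ⟨i, j⟩ h
      rw [HasAntidiagonal.mem_antidiagonal] at h
      simp only at h ⊢
      refine (natDegree_C_mul_X_pow_le _ _).trans ?_
      omega
    · refine (natDegree_C_mul_le _ _).trans ?_
      unfold Rp
      apply natDegree_sum_le_of_forall_le
      rintro ⟨i, j⟩ h
      rw [HasAntidiagonal.mem_antidiagonal] at h
      simp only at h ⊢
      refine (natDegree_C_mul_le _ _).trans ?_
      refine natDegree_mul_le.trans ?_
      rw [natDegree_X_pow]
      have : ((X + C y) ^ (2 * j)).natDegree ≤ 2 * j * 1 :=
        natDegree_pow_le_of_le _ (natDegree_X_add_C y).le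
      omega
    · rw [coeff_zero_eq_eval_zero, coeff_zero_eq_eval_zero, Mp, Rp, eval_finsetSum, eval_mul,
        eval_finsetSum, Finset.Nat.sum_antidiagonal_succ, Finset.Nat.sum_antidiagonal_succ]
      have h1 : ec n 0 = 1 := by simp [ec, poch]
      have h2 : Ac n (p + 1) 0 = 4 ^ n * poch (1 / 2) n := by
        simp only [Ac, poch_zero', Nat.sub_zero, poch_central]
        simp
      simp only [eval_mul, eval_C, eval_pow, eval_X, eval_add, h1, h2]
      have h3 : ∀ i : ℕ, (0 : ℝ) ^ (2 * (i + 1)) = 0 := by intro i; simp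
      have h4 : ∀ i : ℕ, (0 : ℝ) ^ (i + 1) = 0 := by intro i; simp
      simp only [h3, h4, mul_zero, zero_mul, Finset.sum_const_zero, pow_zero, zero_add, add_zero]
      generalize (4 : ℝ) ^ n * poch (1 / 2) n = v at *
      field_simp
    · rw [bop_Mp, bop_C_mul, bop_Rp n y p hp, ih (by omega)]
      have e : 4 * (ec n p / (4 ^ n * poch (1 / 2) n)) = ec n (p + 1) / (4 ^ n * poch (1 / 2) n) *
          (2 * ((p : ℝ) + 1) * (2 * (p + 1) - 2 * n - 1)) := by
        rw [← ec_succ n p]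
        ring
      calc _ = C (4 * (ec n p / (4 ^ n * poch (1 / 2) n))) * (X ^ 2 * Rp n y p) := by
            rw [C_mul]; ring
        _ = _ := by rw [e, C_mul]; ring

/-- Evaluated form. -/
lemma prod_coeff (n p : ℕ) (hp : p ≤ n) (a : ℝ) :
    ∑ q ∈ antidiagonal p, ec n q.1 * ec n q.2 * (1 - a) ^ (2 * q.2) * a ^ (2 * q.1) =
    ec n p / (4 ^ n * poch (1 / 2) n) *
    ∑ q ∈ antidiagonal n, (n.choose q.1 : ℝ) * poch (-(p : ℝ)) q.1 * poch ((n : ℝ) + 1) q.2 *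
      (4 * a * (1 - a)) ^ q.1 := by
  have h := congrArg (eval a) (Mp_eq n (1 - a) p hp)
  rw [Mp, Rp, eval_finsetSum, eval_mul, eval_finsetSum] at h
  simp only [eval_mul, eval_C, eval_pow, eval_X, eval_add] at h
  rw [h]
  congr 1
  rw [Finset.Nat.sum_antidiagonal_eq_sum_range_succ_mk, Finset.Nat.sum_antidiagonal_eq_sum_range_succ_mk]
  simp only
  rw [← Finset.sum_subset (Finset.range_mono (show p + 1 ≤ n + 1 by omega))]
  · apply Finset.sum_congr rfl
    intro r _
    rw [show a + (1 - a) = 1 by ring, Ac, mul_pow, mul_pow, one_pow]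
    ring
  · intro r _ hr
    rw [Finset.mem_range, not_lt] at hr
    rw [poch_neg, Nat.choose_eq_zero_of_lt (by omega : p < r)]
    simp

end PolyPart

section SeriesPart
open Polynomial

/-- Coefficients of the Bessel polynomial. -/
noncomputable def qc (n k : ℕ) : ℝ := ((n.factorial : ℝ) * (2 * n - k).factorial * 2 ^ k) /
      ((2 * n).factorial * (n - k).factorial * k.factorial)

/-- Bessel polynomial as a polynomial. -/
noncomputable def Qp (n : ℕ) : ℝ[X] := ∑ k ∈ Finset.range (n + 1), C (qc n k) * X ^ k

lemma Qp_eval (n : ℕ) (u : ℝ) : (Qp n).eval u = besselQ n u := by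
  rw [Qp, eval_finsetSum]
  simp [besselQ, qc]

lemma Qp_coeff (n k : ℕ) : (Qp n).coeff k = if k ≤ n then qc n k else 0 := by
  simp [Qp]

lemma Qp_natDegree (n : ℕ) : (Qp n).natDegree ≤ n := by
  rw [natDegree_le_iff_coeff_eq_zero]
  intro k hk
  rw [Qp_coeff, if_neg (by omega)]

lemma Qp_coeff_top (n : ℕ) : (Qp n).coeff n ≠ 0 := by
  rw [Qp_coeff, if_pos le_rfl, qc]
  positivity

lemma Qp_rec (n k : ℕ) :
    ((k : ℝ) + 1) * (k - 2 * n) * (Qp n).coeff (k + 1) = 2 * ((k : ℝ) - n) * (Qp n).coeff k := by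
  rw [Qp_coeff, Qp_coeff]
  rcases lt_trichotomy k n with h | h | h
  · rw [if_pos (by omega), if_pos (by omega)]
    obtain ⟨m, rfl⟩ := Nat.exists_eq_add_of_lt h
    unfold qc
    rw [show 2 * (k + m + 1) - (k + 1) = k + 2 * m + 1 by omega,
      show 2 * (k + m + 1) - k = k + 2 * m + 1 + 1 by omega,
      show k + m + 1 - (k + 1) = m by omega, show k + m + 1 - k = m + 1 by omega,
      Nat.factorial_succ (k + 2 * m + 1), Nat.factorial_succ m, Nat.factorial_succ k]
    push_cast
    have h1 : ((2 * (k + m + 1)).factorial : ℝ) ≠ 0 := by positivity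
    have h2 : (m.factorial : ℝ) ≠ 0 := by positivity
    have h3 : (k.factorial : ℝ) ≠ 0 := by positivity
    have h4 : (k : ℝ) + 1 ≠ 0 := by positivity
    have h5 : (m : ℝ) + 1 ≠ 0 := by positivity
    field_simp
    ring
  · subst h
    simp
  · rw [if_neg (by omega), if_neg (by omega)]
    simp

/-- `e^{-u}`. -/
noncomputable def En : PowerSeries ℝ := PowerSeries.rescale (-1 : ℝ) (PowerSeries.exp ℝ)

lemma En_inv : PowerSeries.exp ℝ * En = 1 := by
  exact PowerSeries.exp_mul_exp_neg_eq_one (A := ℝ)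

lemma En_deriv : PowerSeries.derivative ℝ En = - En := by
  ext k
  rw [PowerSeries.coeff_derivative, En, PowerSeries.coeff_rescale, map_neg, PowerSeries.coeff_rescale,
    PowerSeries.coeff_exp, PowerSeries.coeff_exp]
  simp only [eq_ratCast]
  rw [Nat.factorial_succ]
  push_cast
  have h3 : (k.factorial : ℝ) ≠ 0 := by positivity
  have h4 : (k : ℝ) + 1 ≠ 0 := by positivity
  field_simp
  ring

/-- `e^{-u} q_n(u)`. -/
noncomputable def Ys (n : ℕ) : PowerSeries ℝ := En * (Qp n : PowerSeries ℝ)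

lemma Qp_ode (n : ℕ) : X * derivative (derivative (Qp n)) - 2 * X * derivative (Qp n)
    - C (2 * (n : ℝ)) * derivative (Qp n) + C (2 * (n : ℝ)) * Qp n = 0 := by
  ext k
  have h := Qp_rec n k
  rw [coeff_add, coeff_sub, coeff_sub, coeff_C_mul, coeff_C_mul, mul_assoc, coeff_derivative, coeff_ofNat_mul]
  cases k with
  | zero =>
    simp only [mul_coeff_zero, coeff_X_zero, zero_mul, mul_zero, Nat.cast_zero] at h ⊢
    rw [coeff_zero]
    linear_combination h
  | succ k =>
    rw [coeff_X_mul, coeff_X_mul, coeff_derivative, coeff_derivative, coeff_derivative, coeff_zero]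
    push_cast at h ⊢
    linear_combination h

lemma Ys_ode (n : ℕ) : PowerSeries.X * PowerSeries.derivative ℝ (PowerSeries.derivative ℝ (Ys n)) -
    PowerSeries.C (2 * (n : ℝ)) * PowerSeries.derivative ℝ (Ys n) = PowerSeries.X * Ys n := by
  have h := congrArg (fun P : ℝ[X] => (P : PowerSeries ℝ)) (Qp_ode n)
  simp only [Polynomial.coe_add, Polynomial.coe_sub, Polynomial.coe_mul, Polynomial.coe_X,
    Polynomial.coe_C, ← PowerSeries.derivative_coe, Polynomial.coe_zero] at h
  have h2 : ((2 : ℝ[X]) : PowerSeries ℝ) = 2 := by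
    rw [← map_ofNat C 2, Polynomial.coe_C, map_ofNat]
  rw [h2] at h
  have d1 : PowerSeries.derivative ℝ (Ys n) =
      En * (PowerSeries.derivative ℝ (Qp n : PowerSeries ℝ) - (Qp n : PowerSeries ℝ)) := by
    rw [Ys, Derivation.leibniz, En_deriv]
    simp only [smul_eq_mul]
    ring
  rw [d1, Derivation.leibniz, En_deriv, map_sub, Ys]
  simp only [smul_eq_mul]
  linear_combination En * h

lemma Ys_rec (n l : ℕ) : ((l : ℝ) + 2) * (l + 1 - 2 * n) * PowerSeries.coeff (l + 2) (Ys n) =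
    PowerSeries.coeff l (Ys n) := by
  have h := congrArg (PowerSeries.coeff (l + 1)) (Ys_ode n)
  rw [map_sub, PowerSeries.coeff_succ_X_mul, PowerSeries.coeff_succ_X_mul, PowerSeries.coeff_C_mul,
    PowerSeries.coeff_derivative, PowerSeries.coeff_derivative] at h
  rw [← h]
  push_cast
  ring

lemma Ys_one (n : ℕ) (hn : 1 ≤ n) : PowerSeries.coeff 1 (Ys n) = 0 := by
  have h := congrArg (PowerSeries.coeff 0) (Ys_ode n)
  rw [map_sub, PowerSeries.coeff_zero_X_mul, PowerSeries.coeff_zero_X_mul, PowerSeries.coeff_C_mul,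
    PowerSeries.coeff_derivative] at h
  have h2 : (n : ℝ) ≠ 0 := by positivity
  simpa [h2] using h

lemma Ys_zero (n : ℕ) : PowerSeries.coeff 0 (Ys n) = 1 := by
  have h1 : qc n 0 = 1 := by
    unfold qc
    have h1 : ((2 * n).factorial : ℝ) ≠ 0 := by positivity
    have h2 : (n.factorial : ℝ) ≠ 0 := by positivity
    simp
    field_simp
  rw [Ys, PowerSeries.coeff_mul]
  simp [Qp_coeff, h1, En]

lemma Ys_even (n k : ℕ) : PowerSeries.coeff (2 * k) (Ys n) = ec n k / 4 ^ k := by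
  induction k with
  | zero => simp only [Nat.mul_zero, Ys_zero]; simp [ec, poch]
  | succ k ih =>
    have h := Ys_rec n (2 * k)
    rw [ih, ← ec_succ] at h
    have h1 := half_ne n k
    have h2 : (k : ℝ) + 1 ≠ 0 := by positivity
    rw [show 2 * (k + 1) = 2 * k + 2 by ring]
    have h3 : ((k : ℝ) + 1) * (1 / 2 - n + k) * 4 ≠ 0 := mul_ne_zero (mul_ne_zero h2 h1) (by norm_num)
    apply mul_left_cancel₀ h3
    push_cast at h
    rw [pow_succ]
    linear_combination h

lemma Ys_odd (n k : ℕ) (hk : 2 * k + 1 ≤ 2 * n) : PowerSeries.coeff (2 * k + 1) (Ys n) = 0 := by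
  induction k with
  | zero => exact Ys_one n (by omega)
  | succ k ih =>
    have h := Ys_rec n (2 * k + 1)
    rw [ih (by omega)] at h
    have h2 : (k : ℝ) + 1 < n := by
      have : k + 1 < n := by omega
      exact_mod_cast this
    have h3 : (((2 * k + 1 : ℕ) : ℝ) + 2) * (((2 * k + 1 : ℕ) : ℝ) + 1 - 2 * n) ≠ 0 := by
      apply mul_ne_zero
      · positivity
      · push_cast
        linarith
    exact (mul_eq_zero.mp h).resolve_left h3

lemma prod_series (n l : ℕ) (hl : l ≤ 2 * n) (a : ℝ) :
    PowerSeries.coeff l (PowerSeries.rescale a (Ys n) * PowerSeries.rescale (1 - a) (Ys n)) =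
    ∑ i ∈ Finset.range (n + 1), Bc n a i * PowerSeries.coeff l (Ys (n + i)) := by
  rw [PowerSeries.coeff_mul]
  simp only [PowerSeries.coeff_rescale]
  rcases Nat.even_or_odd' l with ⟨p, h | h⟩
  · have h1 : ∀ i ∈ Finset.range (n + 1), Bc n a i * PowerSeries.coeff l (Ys (n + i)) =
        (1 / (4 ^ p * p.factorial)) * (Bc n a i / poch (1 / 2 - (n : ℝ) - i) p) := by
      intro i _
      rw [h, Ys_even, ec]
      push_cast
      rw [← sub_sub]
      have := poch_half_sub_ne n i p
      generalize poch (1 / 2 - (n : ℝ) - i) p = v at *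
      field_simp
    rw [Finset.sum_congr rfl h1, ← Finset.mul_sum, Bc_sum]
    have h2 := prod_coeff n p (by omega) a
    have h3 : ∑ q ∈ antidiagonal p, (1 / 4 ^ p) * (ec n q.1 * ec n q.2 * (1 - a) ^ (2 * q.2) * a ^ (2 * q.1)) =
        ∑ q ∈ antidiagonal l, a ^ q.1 * PowerSeries.coeff q.1 (Ys n) *
          ((1 - a) ^ q.2 * PowerSeries.coeff q.2 (Ys n)) := by
      apply Finset.sum_of_injOn (fun q : ℕ × ℕ => (2 * q.1, 2 * q.2))
      · rintro ⟨i, j⟩ _ ⟨i', j'⟩ _ hh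
        simp only [Prod.mk.injEq] at hh ⊢
        omega
      · rintro ⟨i, j⟩ hh
        simp only [Finset.mem_coe, HasAntidiagonal.mem_antidiagonal] at hh ⊢
        omega
      · rintro ⟨i, j⟩ hh hn
        rw [HasAntidiagonal.mem_antidiagonal] at hh
        simp only at hh ⊢
        rcases Nat.even_or_odd' i with ⟨i', hi | hi⟩
        · exfalso
          apply hn
          refine ⟨(i', p - i'), ?_, ?_⟩
          · simp only [Finset.mem_coe, HasAntidiagonal.mem_antidiagonal]
            omega
          · simp only [Prod.mk.injEq]
            omega
        · rw [hi, Ys_odd n i' (by omega)]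
          simp
      · rintro ⟨i, j⟩ hh
        rw [HasAntidiagonal.mem_antidiagonal] at hh
        simp only at hh ⊢
        rw [Ys_even, Ys_even, ← hh, pow_add]
        field_simp
    rw [← h3, ← Finset.mul_sum, h2, ec]
    field_simp
  · have h1 : ∀ i ∈ Finset.range (n + 1), Bc n a i * PowerSeries.coeff l (Ys (n + i)) = 0 := by
      intro i _
      rw [h, Ys_odd _ _ (by omega), mul_zero]
    rw [Finset.sum_eq_zero h1]
    apply Finset.sum_eq_zero
    rintro ⟨i, j⟩ hh
    rw [HasAntidiagonal.mem_antidiagonal] at hh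
    simp only at hh ⊢
    rcases Nat.even_or_odd' i with ⟨i', hi | hi⟩
    · obtain ⟨j', hj⟩ : ∃ j', j = 2 * j' + 1 := ⟨p - i', by omega⟩
      rw [hj, Ys_odd n j' (by omega)]
      simp
    · rw [hi, Ys_odd n i' (by omega)]
      simp

lemma En_mul_eq_zero (N : ℕ) (P : ℝ[X]) (hP : P.natDegree ≤ N)
    (h : ∀ l ≤ N, PowerSeries.coeff l (En * (P : PowerSeries ℝ)) = 0) : P = 0 := by
  ext l
  rcases Nat.lt_or_ge N l with hl | hl
  · rw [coeff_eq_zero_of_natDegree_lt (by omega), coeff_zero]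
  · have h1 : (P : PowerSeries ℝ) = PowerSeries.exp ℝ * (En * (P : PowerSeries ℝ)) := by
      rw [← mul_assoc, En_inv, one_mul]
    rw [← Polynomial.coeff_coe, h1, PowerSeries.coeff_mul, coeff_zero]
    apply Finset.sum_eq_zero
    intro q hq
    rw [HasAntidiagonal.mem_antidiagonal] at hq
    rw [h q.2 (by omega), mul_zero]

lemma coe_comp_rescale (P : ℝ[X]) (a : ℝ) :
    ((P.comp (C a * X) : ℝ[X]) : PowerSeries ℝ) = PowerSeries.rescale a (P : PowerSeries ℝ) := by
  ext l
  rw [Polynomial.coeff_coe, comp_C_mul_X_coeff, PowerSeries.coeff_rescale, Polynomial.coeff_coe, mul_comm]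

lemma linearization (n : ℕ) (a : ℝ) :
    (Qp n).comp (C a * X) * (Qp n).comp (C (1 - a) * X) =
    ∑ i ∈ Finset.range (n + 1), C (Bc n a i) * Qp (n + i) := by
  rw [← sub_eq_zero]
  apply En_mul_eq_zero (2 * n)
  · apply (natDegree_sub_le _ _).trans
    apply max_le
    · refine natDegree_mul_le.trans ?_
      have h : ∀ b : ℝ, ((Qp n).comp (C b * X)).natDegree ≤ n := by
        intro b
        rw [natDegree_le_iff_coeff_eq_zero]
        intro k hk
        rw [comp_C_mul_X_coeff, Qp_coeff, if_neg (by omega), zero_mul]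
      have h1 := h a
      have h2 := h (1 - a)
      omega
    · apply natDegree_sum_le_of_forall_le
      intro i hi
      rw [Finset.mem_range] at hi
      refine (natDegree_C_mul_le _ _).trans ((Qp_natDegree _).trans ?_)
      omega
  · intro l hl
    have h := prod_series n l hl a
    have hE : PowerSeries.rescale a En * PowerSeries.rescale (1 - a) En = En := by
      have := PowerSeries.exp_mul_exp_eq_exp_add (A := ℝ) (-a) (-(1 - a))
      rw [show -a + -(1 - a) = -1 by ring] at this
      unfold En
      rw [PowerSeries.rescale_rescale, PowerSeries.rescale_rescale]
      simpa using this
    have e1 : En * (((Qp n).comp (C a * X) * (Qp n).comp (C (1 - a) * X) : ℝ[X]) : PowerSeries ℝ) =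
        PowerSeries.rescale a (Ys n) * PowerSeries.rescale (1 - a) (Ys n) := by
      rw [Polynomial.coe_mul, coe_comp_rescale, coe_comp_rescale, Ys, map_mul, map_mul]
      nth_rewrite 1 [← hE]
      ring
    have e2 : PowerSeries.coeff l (En *
        ((∑ i ∈ Finset.range (n + 1), C (Bc n a i) * Qp (n + i) : ℝ[X]) : PowerSeries ℝ)) =
        ∑ i ∈ Finset.range (n + 1), Bc n a i * PowerSeries.coeff l (Ys (n + i)) := by
      have : ((∑ i ∈ Finset.range (n + 1), C (Bc n a i) * Qp (n + i) : ℝ[X]) : PowerSeries ℝ) =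
          ∑ i ∈ Finset.range (n + 1), PowerSeries.C (Bc n a i) * (Qp (n + i) : PowerSeries ℝ) := by
        have := map_sum (Polynomial.coeToPowerSeries.ringHom (R := ℝ))
          (fun i => C (Bc n a i) * Qp (n + i)) (Finset.range (n + 1))
        refine this.trans (Finset.sum_congr rfl fun i _ => ?_)
        rw [map_mul, Polynomial.coeToPowerSeries.ringHom_apply,
          Polynomial.coeToPowerSeries.ringHom_apply, Polynomial.coe_C]
      rw [this, Finset.mul_sum, map_sum]
      apply Finset.sum_congr rfl
      intro i _
      rw [← PowerSeries.coeff_C_mul, Ys]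
      congr 1
      ring
    rw [Polynomial.coe_sub, mul_sub, map_sub, e1, e2, h, sub_self]

lemma Qp_indep (γ : ℕ → ℝ) (N : ℕ) (h : ∑ k ∈ Finset.range N, C (γ k) * Qp k = 0) :
    ∀ k < N, γ k = 0 := by
  induction N with
  | zero => intro k hk; omega
  | succ N ih =>
    have h1 : γ N = 0 := by
      have h2 := congrArg (fun P => coeff P N) h
      simp only [finsetSum_coeff, coeff_C_mul, coeff_zero] at h2
      rw [Finset.sum_range_succ, Finset.sum_eq_zero, zero_add] at h2
      · exact (mul_eq_zero.mp h2).resolve_right (Qp_coeff_top N)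
      · intro k hk
        rw [Finset.mem_range] at hk
        rw [Qp_coeff, if_neg (by omega), mul_zero]
    rw [Finset.sum_range_succ, h1, C_0, zero_mul, add_zero] at h
    intro k hk
    rcases Nat.lt_succ_iff_lt_or_eq.mp hk with h3 | h3
    · exact ih h k h3
    · rw [h3, h1]

lemma beta_eq (n i : ℕ) (hi : i ≤ n) (a : ℝ) (β : ℕ → ℝ)
    (hβ : ∀ u : ℝ, besselQ n (a * u) * besselQ n ((1 - a) * u) =
      ∑ k ∈ Finset.range (n + n + 1), β k * besselQ k u) : β (n + i) = Bc n a i := by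
  have h1 : (Qp n).comp (C a * X) * (Qp n).comp (C (1 - a) * X) =
      ∑ k ∈ Finset.range (n + n + 1), C (β k) * Qp k := by
    apply Polynomial.funext
    intro u
    rw [eval_finsetSum]
    simp only [eval_mul, eval_comp, eval_C, eval_X, Qp_eval]
    exact hβ u
  rw [linearization] at h1
  have h2 : ∑ k ∈ Finset.range (n + n + 1), C (if n ≤ k then Bc n a (k - n) else 0) * Qp k =
      ∑ i ∈ Finset.range (n + 1), C (Bc n a i) * Qp (n + i) := by
    rw [add_assoc, Finset.sum_range_add, Finset.sum_eq_zero, zero_add]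
    · apply Finset.sum_congr rfl
      intro i _
      rw [if_pos (by omega), Nat.add_sub_cancel_left]
    · intro k hk
      rw [Finset.mem_range] at hk
      rw [if_neg (by omega)]
      simp
  have h3 := Qp_indep (fun k => β k - (if n ≤ k then Bc n a (k - n) else 0)) (n + n + 1) (by
    simp only [C_sub, sub_mul]
    rw [Finset.sum_sub_distrib, h2, h1, sub_self]) (n + i) (by omega)
  simp only [if_pos (Nat.le_add_right n i), Nat.add_sub_cancel_left] at h3
  linarith

end SeriesPart

theorem bessel_linearization_equal_degrees
    (n : ℕ) (i : ℕ) (hi : i ≤ n) (a : ℝ)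
    (β : ℕ → ℝ)
    (hβ : ∀ u : ℝ, besselQ n (a * u) * besselQ n ((1 - a) * u) =
      ∑ k ∈ Finset.range (n + n + 1), β k * besselQ k u) :
    β (n + i) = (4 * a * (1 - a)) ^ i / 4 ^ n *
      (poch (-(n : ℝ)) i * poch ((n : ℝ) + 1/2) i) /
        (i.factorial * poch (1/2 - (n : ℝ)) i) *
      ∑ j ∈ Finset.range (n - i + 1),
        poch (-(n : ℝ) + i) j * poch (-(n : ℝ) - 1/2) j /
          (poch (1/2) j * j.factorial) * (2 * a - 1) ^ (2 * j) := by
  exact beta_eq n i hi a β hβ
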